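/- If G is a claw-free graph with minimum degree at least 2, then FTD(G) ≥ 3/2. -/

import Mathlib

/-- The number of members of the family `F` (counted with multiplicity) containing `v`. -/
def appearCount {V : Type*} [DecidableEq V] (F : Multiset (Finset V)) (v : V) : ℕ :=
  Multiset.countP (fun S => v ∈ S) F

/-- `r_F`: the maximum, over all vertices `v`, of the number of members of `F` containing `v`. -/
def maxAppear {V : Type*} [Fintype V] [DecidableEq V] (F : Multiset (Finset V)) : ℕ :=
  Finset.univ.sup fun v : V => appearCount F v

/-- `S` is a total dominating set of `G`: every vertex of `G` has a neighbor in `S`. -/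
def IsTotalDomSet {V : Type*} (G : SimpleGraph V) (S : Finset V) : Prop :=
  ∀ v : V, ∃ u ∈ S, G.Adj v u

/-- The fractional total domatic number `FTD(G)`: the supremum of the effective ratio
`|F| / r_F` over all nonempty thoroughly distributed families `F` of `G`, i.e. finite
families (with repetition allowed) of total dominating sets of `G`. -/
noncomputable def FTD {V : Type*} [Fintype V] [DecidableEq V] (G : SimpleGraph V) : ℝ :=
  sSup { r : ℝ | ∃ F : Multiset (Finset V), F ≠ 0 ∧ (∀ S ∈ F, IsTotalDomSet G S) ∧
      r = (Multiset.card F : ℝ) / (maxAppear F : ℝ) }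

open Classical in
theorem degen_color {V : Type*} [Fintype V] (H : SimpleGraph V)
    (h : ∀ W : Finset V, W.Nonempty → ∃ x ∈ W, (W.filter (fun y => H.Adj x y)).card ≤ 2) :
    ∃ c : V → Fin 3, ∀ a b, H.Adj a b → c a ≠ c b := by
  have key : ∀ n : ℕ, ∀ W : Finset V, W.card = n →
      ∃ c : V → Fin 3, ∀ a ∈ W, ∀ b ∈ W, H.Adj a b → c a ≠ c b := by
    intro n
    induction n with
    | zero =>
      intro W hW
      rw [Finset.card_eq_zero] at hW
      subst hW
      exact ⟨fun _ => 0, by simp⟩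
    | succ n ih =>
      intro W hW
      obtain ⟨x, hx, hc⟩ := h W (Finset.card_pos.mp (by omega))
      obtain ⟨c, hcc⟩ := ih (W.erase x) (by rw [Finset.card_erase_of_mem hx]; omega)
      have : ∃ k : Fin 3, k ∉ (W.filter (fun y => H.Adj x y)).image c := by
        by_contra hcon
        push Not at hcon
        have h1 : (Finset.univ : Finset (Fin 3)) ⊆ (W.filter (fun y => H.Adj x y)).image c :=
          fun k _ => hcon k
        have h2 := Finset.card_le_card h1
        have h3 := Finset.card_image_le (s := W.filter (fun y => H.Adj x y)) (f := c)
        simp at h2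
        omega
      obtain ⟨k, hk⟩ := this
      have hk' : ∀ y ∈ W, H.Adj x y → c y ≠ k := by
        intro y hy hxy hyk
        exact hk (Finset.mem_image.mpr ⟨y, by simp [hy, hxy], hyk⟩)
      refine ⟨fun v => if v = x then k else c v, ?_⟩
      intro a ha b hb hab
      by_cases hax : a = x
      · subst hax
        have : b ≠ a := hab.ne'
        simp only [this, if_true, if_false]
        exact (hk' b hb hab).symm
      · by_cases hbx : b = x
        · subst hbx
          simp only [hax, if_true, if_false]
          exact hk' a ha hab.symm
        · simp only [hax, hbx, if_false]
          exact hcc a (by simp [ha, hax]) b (by simp [hb, hbx]) hab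
  obtain ⟨c, hc⟩ := key _ Finset.univ rfl
  exact ⟨c, fun a b hab => hc a (by simp) b (by simp) hab⟩

/-- at least two neighbours -/
def DegTwo {V : Type*} (K : SimpleGraph V) (v : V) : Prop :=
  ∃ a b, a ≠ b ∧ K.Adj v a ∧ K.Adj v b

/-- at least three neighbours -/
def DegThree {V : Type*} (K : SimpleGraph V) (v : V) : Prop :=
  ∃ a b c, a ≠ b ∧ a ≠ c ∧ b ≠ c ∧ K.Adj v a ∧ K.Adj v b ∧ K.Adj v c

theorem exists_color {V : Type*} [Finite V] (G : SimpleGraph V)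
    (hclaw : ∀ v a b c, a ≠ b → a ≠ c → b ≠ c → G.Adj v a → G.Adj v b → G.Adj v c →
      G.Adj a b ∨ G.Adj a c ∨ G.Adj b c)
    (hδ : ∀ v, DegTwo G v) :
    ∃ c : V → Fin 3, ∀ v, ∃ a b, G.Adj v a ∧ G.Adj v b ∧ c a ≠ c b := by
  classical
  have := Fintype.ofFinite V
  obtain ⟨K, ⟨hKG, hK⟩, hmin⟩ := Set.exists_min_image
    {K : SimpleGraph V | K ≤ G ∧ ∀ v, DegTwo K v} (fun K => K.edgeSet.ncard)
    (Set.toFinite _) ⟨G, le_refl _, hδ⟩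
  replace hmin : ∀ K' : SimpleGraph V, (K' ≤ G ∧ ∀ v, DegTwo K' v) →
      K.edgeSet.ncard ≤ K'.edgeSet.ncard := fun K' hK' => hmin K' hK'
  have hone : ∀ x y, K.Adj x y → DegThree K x → ¬ DegThree K y := by
    intro x y hxy hx hy
    have h1 := hmin (K.deleteEdges {s(x, y)}) ⟨(K.deleteEdges_le _).trans hKG, ?_⟩
    · rw [SimpleGraph.edgeSet_deleteEdges] at h1
      have : (K.edgeSet \ {s(x, y)}).ncard < K.edgeSet.ncard :=
        Set.ncard_sdiff_singleton_lt_of_mem hxy (Set.toFinite _)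
      omega
    · intro v
      have hv := hK v
      unfold DegTwo DegThree at *
      simp only [SimpleGraph.deleteEdges_adj, Set.mem_singleton_iff, Sym2.eq_iff]
      by_cases hvx : v = x
      · subst hvx
        obtain ⟨a, b, c, hab, hac, hbc, ha, hb, hc⟩ := hx
        have := hxy.ne
        by_cases h1 : a = y
        · exact ⟨b, c, hbc, ⟨hb, by grind⟩, ⟨hc, by grind⟩⟩
        · by_cases h2 : b = y
          · exact ⟨a, c, hac, ⟨ha, by grind⟩, ⟨hc, by grind⟩⟩
          · exact ⟨a, b, hab, ⟨ha, by grind⟩, ⟨hb, by grind⟩⟩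
      · by_cases hvy : v = y
        · subst hvy
          obtain ⟨a, b, c, hab, hac, hbc, ha, hb, hc⟩ := hy
          by_cases h1 : a = x
          · exact ⟨b, c, hbc, ⟨hb, by grind⟩, ⟨hc, by grind⟩⟩
          · by_cases h2 : b = x
            · exact ⟨a, c, hac, ⟨ha, by grind⟩, ⟨hc, by grind⟩⟩
            · exact ⟨a, b, hab, ⟨ha, by grind⟩, ⟨hb, by grind⟩⟩
        · obtain ⟨a, b, hab, ha, hb⟩ := hv
          exact ⟨a, b, hab, ⟨ha, by grind⟩, ⟨hb, by grind⟩⟩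
  have hex : ∀ B x₁ x₂ y₁ y₂, DegThree K B → DegThree K y₁ → DegThree K y₂ → x₁ ≠ x₂ →
      y₁ ≠ B → y₂ ≠ B → K.Adj B x₁ → K.Adj B x₂ → K.Adj x₁ y₁ → K.Adj x₂ y₂ →
      ¬ G.Adj x₁ x₂ := by
    intro B x₁ x₂ y₁ y₂ hB hy₁ hy₂ hx hyB₁ hyB₂ hBx₁ hBx₂ hxy₁ hxy₂ hG
    have hx₁ := hone _ _ hBx₁ hB
    have hx₂ := hone _ _ hBx₂ hB
    have n1 : y₁ ≠ x₂ := by rintro rfl; exact hx₂ hy₁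
    have n2 : y₂ ≠ x₁ := by rintro rfl; exact hx₁ hy₂
    have n3 : B ≠ x₁ := hBx₁.ne
    have n4 : B ≠ x₂ := hBx₂.ne
    have n5 : x₁ ≠ y₁ := hxy₁.ne
    have n6 : x₂ ≠ y₂ := hxy₂.ne
    have h1 := hmin (K.deleteEdges {s(B, x₁), s(x₂, y₂)} ⊔ SimpleGraph.edge x₁ x₂) ⟨?_, ?_⟩
    · have hsub : (K.deleteEdges {s(B, x₁), s(x₂, y₂)} ⊔ SimpleGraph.edge x₁ x₂).edgeSet ⊆
          insert s(x₁, x₂) (K.edgeSet \ {s(B, x₁), s(x₂, y₂)}) := by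
        rw [SimpleGraph.edgeSet_sup, SimpleGraph.edgeSet_deleteEdges,
          SimpleGraph.edgeSet_edge_of_ne hx]
        intro e he
        simp only [Set.mem_union, Set.mem_insert_iff, Set.mem_singleton_iff] at he ⊢
        tauto
      have h2 := Set.ncard_le_ncard hsub (Set.toFinite _)
      have h3 := Set.ncard_insert_le s(x₁, x₂) (K.edgeSet \ {s(B, x₁), s(x₂, y₂)})
      have hp : ({s(B, x₁), s(x₂, y₂)} : Set (Sym2 V)).ncard = 2 :=
        Set.ncard_pair (by rw [Ne, Sym2.eq_iff]; grind)
      have hs : ({s(B, x₁), s(x₂, y₂)} : Set (Sym2 V)) ⊆ K.edgeSet := by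
        rintro e (rfl | rfl)
        · exact hBx₁
        · exact hxy₂
      have h4 := Set.ncard_sdiff_add_ncard_of_subset hs (Set.toFinite _)
      omega
    · refine sup_le ((K.deleteEdges_le _).trans hKG) ?_
      intro a b hab
      rw [SimpleGraph.edge_adj] at hab
      rcases hab with ⟨⟨rfl, rfl⟩ | ⟨rfl, rfl⟩, _⟩
      · exact hG
      · exact hG.symm
    · intro v
      have hv := hK v
      unfold DegTwo DegThree at *
      simp only [SimpleGraph.sup_adj, SimpleGraph.edge_adj, SimpleGraph.deleteEdges_adj,
        Set.mem_insert_iff, Set.mem_singleton_iff, Sym2.eq_iff]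
      by_cases h1 : v = x₁
      · subst h1
        exact ⟨y₁, x₂, n1, Or.inl ⟨hxy₁, by grind⟩, Or.inr (by grind)⟩
      by_cases h2 : v = x₂
      · subst h2
        exact ⟨B, x₁, n3, Or.inl ⟨hBx₂.symm, by grind⟩, Or.inr (by grind)⟩
      by_cases h3 : v = B
      · subst h3
        obtain ⟨a, b, c, hab, hac, hbc, ha, hb, hc⟩ := hB
        by_cases h1 : a = x₁
        · exact ⟨b, c, hbc, Or.inl ⟨hb, by grind⟩, Or.inl ⟨hc, by grind⟩⟩
        · by_cases h2 : b = x₁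
          · exact ⟨a, c, hac, Or.inl ⟨ha, by grind⟩, Or.inl ⟨hc, by grind⟩⟩
          · exact ⟨a, b, hab, Or.inl ⟨ha, by grind⟩, Or.inl ⟨hb, by grind⟩⟩
      by_cases h4 : v = y₂
      · subst h4
        obtain ⟨a, b, c, hab, hac, hbc, ha, hb, hc⟩ := hy₂
        by_cases h1 : a = x₂
        · exact ⟨b, c, hbc, Or.inl ⟨hb, by grind⟩, Or.inl ⟨hc, by grind⟩⟩
        · by_cases h2 : b = x₂
          · exact ⟨a, c, hac, Or.inl ⟨ha, by grind⟩, Or.inl ⟨hc, by grind⟩⟩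
          · exact ⟨a, b, hab, Or.inl ⟨ha, by grind⟩, Or.inl ⟨hb, by grind⟩⟩
      obtain ⟨a, b, hab, ha, hb⟩ := hv
      exact ⟨a, b, hab, Or.inl ⟨ha, by grind⟩, Or.inl ⟨hb, by grind⟩⟩
  choose p q hpq hp hq using hK
  obtain ⟨H, hHdef⟩ : ∃ H : SimpleGraph V,
      ∀ a b, H.Adj a b ↔ ∃ v, (p v = a ∧ q v = b) ∨ (p v = b ∧ q v = a) :=
   ⟨{ Adj := fun a b => ∃ v, (p v = a ∧ q v = b) ∨ (p v = b ∧ q v = a)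
      symm := ⟨fun a b ⟨v, h⟩ => ⟨v, h.symm⟩⟩
      loopless := ⟨fun a ⟨v, h⟩ => hpq v (by rcases h with h | h <;> rw [h.1, h.2])⟩ },
    fun a b => Iff.rfl⟩
  have hH : ∀ a b, H.Adj a b → ∃ v, K.Adj a v ∧ K.Adj v b ∧ a ≠ b ∧
      b = if p v = a then q v else p v := by
    intro a b hab
    obtain ⟨v, ⟨h1, h2⟩ | ⟨h1, h2⟩⟩ := (hHdef a b).mp hab
    · subst h1 h2
      exact ⟨v, (hp v).symm, hq v, hpq v, by simp⟩
    · subst h1 h2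
      exact ⟨v, (hq v).symm, hp v, (hpq v).symm, by simp [hpq v]⟩
  obtain ⟨c, hc⟩ := degen_color H (by
    intro W hW
    by_cases hcase : ∃ x ∈ W, ¬ DegThree K x
    · obtain ⟨x, hx, hd⟩ := hcase
      refine ⟨x, hx, ?_⟩
      have h1 : W.filter (fun y => H.Adj x y) ⊆
          (Finset.univ.filter (fun v => K.Adj x v)).image
            (fun v => if p v = x then q v else p v) := by
        intro y hy
        obtain ⟨v, h1, h2, h3, h4⟩ := hH x y (Finset.mem_filter.mp hy).2
        exact Finset.mem_image.mpr ⟨v, by simp [h1], h4.symm⟩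
      refine (Finset.card_le_card h1).trans (Finset.card_image_le.trans ?_)
      by_contra hcon
      push Not at hcon
      obtain ⟨a, b, c, ha, hb, hc, hab, hac, hbc⟩ := Finset.two_lt_card_iff.mp hcon
      simp only [Finset.mem_filter, Finset.mem_univ, true_and] at ha hb hc
      exact hd ⟨a, b, c, hab, hac, hbc, ha, hb, hc⟩
    · push Not at hcase
      obtain ⟨x, hx⟩ := hW
      refine ⟨x, hx, ?_⟩
      have h1 : W.filter (fun y => H.Adj x y) ⊆
          (Finset.univ.filter
            (fun v => K.Adj x v ∧ ∃ y, K.Adj v y ∧ y ≠ x ∧ DegThree K y)).image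
            (fun v => if p v = x then q v else p v) := by
        intro y hy
        rw [Finset.mem_filter] at hy
        obtain ⟨v, h1, h2, h3, h4⟩ := hH x y hy.2
        refine Finset.mem_image.mpr ⟨v, ?_, h4.symm⟩
        simp only [Finset.mem_filter, Finset.mem_univ, true_and]
        exact ⟨h1, y, h2, h3.symm, hcase y hy.1⟩
      refine (Finset.card_le_card h1).trans (Finset.card_image_le.trans ?_)
      by_contra hcon
      push Not at hcon
      obtain ⟨a, b, c, ha, hb, hc, hab, hac, hbc⟩ := Finset.two_lt_card_iff.mp hcon
      simp only [Finset.mem_filter, Finset.mem_univ, true_and] at ha hb hc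
      obtain ⟨ha, y₁, a1, a2, a3⟩ := ha
      obtain ⟨hb, y₂, b1, b2, b3⟩ := hb
      obtain ⟨hc, y₃, c1, c2, c3⟩ := hc
      have hB := hcase x hx
      rcases hclaw x a b c hab hac hbc (hKG ha) (hKG hb) (hKG hc) with h | h | h
      · exact hex x a b y₁ y₂ hB a3 b3 hab a2 b2 ha hb a1 b1 h
      · exact hex x a c y₁ y₃ hB a3 c3 hac a2 c2 ha hc a1 c1 h
      · exact hex x b c y₂ y₃ hB b3 c3 hbc b2 c2 hb hc b1 c1 h)
  exact ⟨c, fun v => ⟨p v, q v, hKG (hp v), hKG (hq v), hc _ _ ((hHdef _ _).mpr ⟨v, Or.inl ⟨rfl, rfl⟩⟩)⟩⟩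

theorem card_le_sum_appear {V : Type*} [Fintype V] [DecidableEq V] (F : Multiset (Finset V))
    (h : ∀ S ∈ F, S.Nonempty) : Multiset.card F ≤ ∑ v : V, appearCount F v := by
  induction F using Multiset.induction_on with
  | empty => simp
  | cons S F ih =>
    have h1 := ih (fun T hT => h T (Multiset.mem_cons_of_mem hT))
    have h2 := Finset.card_pos.mpr (h S (Multiset.mem_cons_self S F))
    have h3 : ∑ v : V, appearCount (S ::ₘ F) v = ∑ v : V, appearCount F v + S.card := by
      simp only [appearCount, Multiset.countP_cons, Finset.sum_add_distrib]
      simp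
    rw [h3, Multiset.card_cons]
    omega

theorem stmt13 {V : Type*} [Fintype V] [DecidableEq V] (G : SimpleGraph V)
    [DecidableRel G.Adj]
    (hclaw : IsEmpty (completeBipartiteGraph Unit (Fin 3) ↪g G))
    (hδ : 2 ≤ G.minDegree) :
    3 / 2 ≤ FTD G := by
  have hne : Nonempty V := by
    by_contra hcon
    rw [not_nonempty_iff] at hcon
    rw [SimpleGraph.minDegree_of_subsingleton] at hδ
    omega
  obtain ⟨c, hc⟩ := exists_color G (by
    intro v a b c hab hac hbc ha hb hc
    by_contra hcon
    push Not at hcon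
    obtain ⟨h1, h2, h3⟩ := hcon
    have h1' := fun h => h1 (G.adj_symm h)
    have h2' := fun h => h2 (G.adj_symm h)
    have h3' := fun h => h3 (G.adj_symm h)
    refine hclaw.false ⟨⟨Sum.elim (fun _ => v) ![a, b, c], ?_⟩, ?_⟩
    · rintro (x | x) (y | y) h
      · rfl
      · exfalso
        fin_cases y <;> simp at h
        · exact ha.ne h
        · exact hb.ne h
        · exact hc.ne h
      · exfalso
        fin_cases x <;> simp at h
        · exact ha.ne' h
        · exact hb.ne' h
        · exact hc.ne' h
      · fin_cases x <;> fin_cases y <;> simp_all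
    · intro x y
      change G.Adj (Sum.elim (fun _ => v) ![a, b, c] x) (Sum.elim (fun _ => v) ![a, b, c] y) ↔ _
      rcases x with x | x <;> rcases y with y | y
      · simp
      · fin_cases y <;> simp [ha, hb, hc]
      · fin_cases x <;> simp [ha.symm, hb.symm, hc.symm]
      · fin_cases x <;> fin_cases y <;> simp_all) (by
    intro v
    have h1 : 1 < (G.neighborFinset v).card := by
      rw [SimpleGraph.card_neighborFinset_eq_degree]
      have := G.minDegree_le_degree v
      omega
    obtain ⟨a, ha, b, hb, hab⟩ := Finset.one_lt_card.mp h1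
    exact ⟨a, b, hab, by simpa using ha, by simpa using hb⟩)
  let S : Fin 3 → Finset V := fun i => Finset.univ.filter (fun v => c v ≠ i)
  have hcount : ∀ v, appearCount ({S 0, S 1, S 2} : Multiset (Finset V)) v = 2 := by
    intro v
    have : c v = 0 ∨ c v = 1 ∨ c v = 2 := by
      generalize c v = k
      revert k
      decide
    simp only [appearCount, Multiset.insert_eq_cons, Multiset.countP_cons,
      ← Multiset.cons_zero, Multiset.countP_zero]
    rcases this with h | h | h <;> simp [S, h]
  have hmax : maxAppear ({S 0, S 1, S 2} : Multiset (Finset V)) = 2 := by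
    unfold maxAppear
    simp only [hcount]
    exact Finset.sup_const Finset.univ_nonempty 2
  have hS : ∀ i, IsTotalDomSet G (S i) := by
    intro i v
    obtain ⟨a, b, ha, hb, hab⟩ := hc v
    by_cases h : c a = i
    · exact ⟨b, by simp [S]; rintro rfl; exact hab h, hb⟩
    · exact ⟨a, by simp [S, h], ha⟩
  refine le_csSup ?_ ⟨{S 0, S 1, S 2}, by simp, ?_, ?_⟩
  · refine ⟨(Fintype.card V : ℝ), ?_⟩
    rintro r ⟨F, hF, hdom, rfl⟩
    refine div_le_of_le_mul₀ (by positivity) (by positivity) ?_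
    have h1 := card_le_sum_appear F (fun T hT => by
      obtain ⟨v⟩ := hne
      obtain ⟨u, hu, _⟩ := hdom T hT v
      exact ⟨u, hu⟩)
    have h2 : ∑ v : V, appearCount F v ≤ ∑ _v : V, maxAppear F :=
      Finset.sum_le_sum (fun v _ => Finset.le_sup (f := fun v => appearCount F v)
        (Finset.mem_univ v))
    rw [Finset.sum_const, Finset.card_univ, smul_eq_mul] at h2
    exact_mod_cast h1.trans h2
  · intro T hT
    simp only [Multiset.insert_eq_cons, Multiset.mem_cons, Multiset.mem_singleton] at hT
    rcases hT with rfl | rfl | rfl <;> exact hS _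
  · rw [hmax]
    simp
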